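/- Let εₙ ∈ (0, 1/|𝒫|) with εₙ → 0; let η be the uniform distribution on Δ (the normalized (|𝒫|−1)-dimensional Hausdorff measure restricted to the simplex Δ), and for each n and each edge e define C_e^{εₙ}(x) = (1 − εₙ) C_e(x) + εₙ ∫_Δ C_e(τ′(e)) dη(τ′). For each n, let τⁿ ∈ Δ minimize Σ_{e ∈ E} ∫_0^{τ(e)} C_e^{εₙ}(x) dx over {τ ∈ Δ : τ(p) ≥ εₙ for every p ∈ 𝒫}, and let τ* be a limit point of the sequence (τⁿ). Then every measurable pure strategy profile f : I → 𝒫 with λ ∘ f⁻¹ = τ* is a pure strategy robust perfect equilibrium of the congestion game. -/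

import Mathlib

open MeasureTheory Filter Topology

section RobustPerfect

variable {I : Type*} [MeasurableSpace I] {A : Type*} [Fintype A]

/-- The societal summary of a randomized strategy profile. -/
noncomputable def socSum (lam : Measure I) (h : I → A → ℝ) : A → ℝ :=
  fun a => ∫ i, h i a ∂lam

/-- `h` is a randomized strategy profile: a measurable map into the simplex. -/
def IsProfile (lam : Measure I) (h : I → A → ℝ) : Prop :=
  Measurable h ∧ ∀ i, h i ∈ stdSimplex ℝ A

/-- A large game: payoffs continuous on the simplex and measurable in the player. -/
def IsLargeGame (u : I → A → (A → ℝ) → ℝ) : Prop :=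
  (∀ i a, ContinuousOn (u i a) (stdSimplex ℝ A)) ∧
  (∀ (a : A) (τ : A → ℝ), τ ∈ stdSimplex ℝ A → Measurable fun i => u i a τ)

/-- An atomless measure. -/
def MeasAtomless (lam : Measure I) : Prop :=
  ∀ s : Set I, MeasurableSet s → 0 < lam s →
    ∃ t : Set I, MeasurableSet t ∧ t ⊆ s ∧ 0 < lam t ∧ lam t < lam s

/-- A Borel probability measure concentrated on the simplex with full support on it. -/
def FullSupportOnSimplex (η : Measure (A → ℝ)) : Prop :=
  IsProbabilityMeasure η ∧ η (stdSimplex ℝ A)ᶜ = 0 ∧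
    ∀ U : Set (A → ℝ), IsOpen U → (U ∩ stdSimplex ℝ A).Nonempty → 0 < η U

/-- A perturbation function: a Borel measurable map from the simplex to the
full-support Borel probability measures on the simplex. -/
def IsPerturbation (φ : (A → ℝ) → Measure (A → ℝ)) : Prop :=
  (∀ τ ∈ stdSimplex ℝ A, FullSupportOnSimplex (φ τ)) ∧
  ∀ f : (A → ℝ) → ℝ, Continuous f → Measurable fun τ => ∫ x, f x ∂(φ τ)

/-- Expected payoff of action `a` against a distribution over societal summaries. -/
noncomputable def payM (ui : A → (A → ℝ) → ℝ) (a : A) (ν : Measure (A → ℝ)) : ℝ :=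
  ∫ τ, ui a τ ∂ν

/-- Randomized strategy Nash equilibrium. -/
def IsNash (lam : Measure I) (u : I → A → (A → ℝ) → ℝ) (h : I → A → ℝ) : Prop :=
  IsProfile lam h ∧
  ∀ᵐ i ∂lam, ∀ μ ∈ stdSimplex ℝ A,
    ∑ a, μ a * u i a (socSum lam h) ≤ ∑ a, h i a * u i a (socSum lam h)

/-- A weakly dominated action. -/
def WeaklyDominated (ui : A → (A → ℝ) → ℝ) (a : A) : Prop :=
  ∃ μ ∈ stdSimplex ℝ A,
    (∀ τ ∈ stdSimplex ℝ A, ui a τ ≤ ∑ b, μ b * ui b τ) ∧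
    (∃ τ ∈ stdSimplex ℝ A, ui a τ < ∑ b, μ b * ui b τ)

/-- Admissibility: almost no player puts weight on a weakly dominated action. -/
def Admissible (lam : Measure I) (u : I → A → (A → ℝ) → ℝ) (h : I → A → ℝ) : Prop :=
  ∀ᵐ i ∂lam, ∀ a : A, WeaklyDominated (u i) a → h i a = 0

/-- Weak convergence of a sequence of measures to a Dirac measure. -/
def WeakTendstoDirac (ν : ℕ → Measure (A → ℝ)) (τ : A → ℝ) : Prop :=
  ∀ f : (A → ℝ) → ℝ, Continuous f →
    Tendsto (fun n => ∫ x, f x ∂(ν n)) atTop (nhds (f τ))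

/-- Aggregate robustness. -/
def AggregateRobust (lam : Measure I) (u : I → A → (A → ℝ) → ℝ) (h : I → A → ℝ) : Prop :=
  ∀ᵐ i ∂lam, ∃ φ : ℕ → (A → ℝ) → Measure (A → ℝ),
    (∀ n, IsPerturbation (φ n)) ∧
    (∀ τ ∈ stdSimplex ℝ A, WeakTendstoDirac (fun n => φ n τ) τ) ∧
    ∀ n, ∀ μ ∈ stdSimplex ℝ A,
      ∑ a, μ a * payM (u i) a (φ n (socSum lam h)) ≤
        ∑ a, h i a * payM (u i) a (φ n (socSum lam h))

/-- `ε`-robust perfect equilibrium with perturbed player space `Iε` and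
perturbation function `φ`. -/
def IsEpsRPE (lam : Measure I) (u : I → A → (A → ℝ) → ℝ) (ε : ℝ)
    (h : I → A → ℝ) (Iε : Set I) (φ : (A → ℝ) → Measure (A → ℝ)) : Prop :=
  IsProfile lam h ∧
  (∀ᵐ i ∂lam, ∀ a : A, 0 < h i a) ∧
  MeasurableSet Iε ∧ ENNReal.ofReal (1 - ε) < lam Iε ∧
  IsPerturbation φ ∧
  (∀ τ ∈ stdSimplex ℝ A, ENNReal.ofReal (1 - ε) ≤ φ τ {τ}) ∧
  ∀ i ∈ Iε, ∀ am al : A,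
    payM (u i) am (φ (socSum lam h)) < payM (u i) al (φ (socSum lam h)) →
      h i am ≤ ε

/-- Robust perfect equilibrium. -/
def IsRPE (lam : Measure I) (u : I → A → (A → ℝ) → ℝ) (h : I → A → ℝ) : Prop :=
  IsProfile lam h ∧
  ∃ (ε : ℕ → ℝ) (hs : ℕ → I → A → ℝ) (Is : ℕ → Set I)
      (φs : ℕ → (A → ℝ) → Measure (A → ℝ)),
    (∀ n, 0 < ε n) ∧ Tendsto ε atTop (nhds 0) ∧
    (∀ n, IsEpsRPE lam u (ε n) (hs n) (Is n) (φs n)) ∧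
    (∀ᵐ i ∂lam, ∃ nk : ℕ → ℕ, StrictMono nk ∧ (∀ k, i ∈ Is (nk k)) ∧
      Tendsto (fun k => hs (nk k) i) atTop (nhds (h i))) ∧
    Tendsto (fun n => socSum lam (hs n)) atTop (nhds (socSum lam h))

/-- The Dirac randomized strategy profile induced by a pure strategy profile. -/
def diracProfile [DecidableEq A] (f : I → A) : I → A → ℝ :=
  fun i a => if a = f i then 1 else 0

end RobustPerfect

section Congestion

variable {E P : Type*} [Fintype E] [Fintype P] [DecidableEq E]

/-- The load of edge `e` under the path-flow `τ`. -/
def edgeLoad (edgeOf : P → Finset E) (τ : P → ℝ) (e : E) : ℝ :=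
  ∑ p : P, if e ∈ edgeOf p then τ p else 0

/-- The cost of path `p` under the path-flow `τ`. -/
def pathCost (edgeOf : P → Finset E) (C : E → ℝ → ℝ) (p : P) (τ : P → ℝ) : ℝ :=
  ∑ e ∈ edgeOf p, C e (edgeLoad edgeOf τ e)

/-- Nonnegative, continuous and monotone increasing edge cost functions on `[0,1]`. -/
def IsCongestionCost (C : E → ℝ → ℝ) : Prop :=
  ∀ e, ContinuousOn (C e) (Set.Icc (0:ℝ) 1) ∧ MonotoneOn (C e) (Set.Icc (0:ℝ) 1) ∧
    ∀ x ∈ Set.Icc (0:ℝ) 1, 0 ≤ C e x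

/-- The common payoff of the congestion game: the negative of the path cost. -/
def congPayoff (I : Type*) (edgeOf : P → Finset E) (C : E → ℝ → ℝ) :
    I → P → (P → ℝ) → ℝ :=
  fun _ p τ => -(pathCost edgeOf C p τ)

/-- The uniform distribution on the simplex: the normalized
`(card P - 1)`-dimensional Hausdorff measure restricted to the simplex. -/
noncomputable def unifSimplex (P : Type*) [Fintype P] : Measure (P → ℝ) :=
  (μH[(Fintype.card P : ℝ) - 1] (stdSimplex ℝ P))⁻¹ •
    (μH[(Fintype.card P : ℝ) - 1]).restrict (stdSimplex ℝ P)

/-- The perturbation function `τ ↦ (1-ε)δ_τ + ε η`. -/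
noncomputable def pertOf {A : Type*} [Fintype A] (ε : ℝ) (η : Measure (A → ℝ)) :
    (A → ℝ) → Measure (A → ℝ) :=
  fun τ => ENNReal.ofReal (1 - ε) • Measure.dirac τ + ENNReal.ofReal ε • η

end Congestion

/-- The perturbed edge cost `C_e^ε(x) = (1-ε) C_e(x) + ε ∫_Δ C_e(τ'(e)) dη(τ')`,
with `η` the uniform distribution on the simplex. -/
noncomputable def pertCost {E P : Type*} [Fintype E] [Fintype P] [DecidableEq E]
    (edgeOf : P → Finset E) (C : E → ℝ → ℝ) (ε : ℝ) (e : E) (x : ℝ) : ℝ :=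
  (1 - ε) * C e x + ε * ∫ τ', C e (edgeLoad edgeOf τ' e) ∂(unifSimplex P)

/-- Reconstruct a point of the affine hyperplane `∑ x = 1` from all coordinates but `p₀`. -/
noncomputable def simplexLift {P : Type*} [Fintype P] [DecidableEq P] (p₀ : P)
    (y : {p : P // p ≠ p₀} → ℝ) : P → ℝ :=
  fun p => if h : p = p₀ then 1 - ∑ q, y q else y ⟨p, h⟩

section UniformSimplex

variable {P : Type*} [Fintype P]

lemma continuous_simplexLift [DecidableEq P] (p₀ : P) : Continuous (simplexLift p₀) := by
  refine continuous_pi fun p => ?_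
  by_cases h : p = p₀
  · simp only [simplexLift, h, dif_pos]
    fun_prop
  · simp only [simplexLift, h, dif_neg, not_false_eq_true]
    fun_prop

lemma lipschitzWith_simplexLift [DecidableEq P] (p₀ : P) :
    LipschitzWith (Fintype.card P) (simplexLift p₀) := by
  refine LipschitzWith.of_dist_le_mul fun x y => ?_
  have hcard : (1 : ℝ) ≤ Fintype.card P := by
    exact_mod_cast Fintype.card_pos_iff.mpr ⟨p₀⟩
  rw [dist_pi_le_iff (by positivity)]
  intro p
  by_cases h : p = p₀
  · simp only [simplexLift, h, dif_pos]
    rw [Real.dist_eq]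
    calc |1 - ∑ q, x q - (1 - ∑ q, y q)| = |∑ q, (y q - x q)| := by
          rw [Finset.sum_sub_distrib]; congr 1; ring
      _ ≤ ∑ q : {p : P // p ≠ p₀}, |y q - x q| := Finset.abs_sum_le_sum_abs _ _
      _ ≤ ∑ q : {p : P // p ≠ p₀}, dist x y := by
          refine Finset.sum_le_sum fun q _ => ?_
          rw [← Real.dist_eq, dist_comm]
          exact dist_le_pi_dist x y q
      _ = (Fintype.card {p : P // p ≠ p₀} : ℝ) * dist x y := by simp
      _ ≤ _ := by
          have := Fintype.card_subtype_le (fun p : P => p ≠ p₀)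
          push_cast
          gcongr
  · simp only [simplexLift, h, dif_neg, not_false_eq_true]
    push_cast
    calc _ ≤ dist x y := dist_le_pi_dist x y ⟨p, h⟩
      _ ≤ _ := le_mul_of_one_le_left dist_nonneg hcard

lemma sum_simplexLift [DecidableEq P] (p₀ : P) (y : {p : P // p ≠ p₀} → ℝ) :
    ∑ p, simplexLift p₀ y p = 1 := by
  rw [Fintype.sum_eq_add_sum_subtype_ne _ p₀]
  have : ∀ q : {p : P // p ≠ p₀}, simplexLift p₀ y q = y q := fun q => by
    simp [simplexLift, q.2]
  simp only [this]
  simp [simplexLift]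

lemma simplexLift_restrict [DecidableEq P] (p₀ : P) {x : P → ℝ} (hx : ∑ p, x p = 1) :
    simplexLift p₀ (fun q => x q) = x := by
  rw [Fintype.sum_eq_add_sum_subtype_ne _ p₀] at hx
  funext p
  by_cases h : p = p₀
  · subst h
    simp only [simplexLift, dif_pos]
    linarith
  · simp [simplexLift, h]

lemma restrict_simplexLift [DecidableEq P] (p₀ : P) (y : {p : P // p ≠ p₀} → ℝ) :
    (fun q : {p : P // p ≠ p₀} => simplexLift p₀ y q) = y := by
  funext q
  simp [simplexLift, q.2]

lemma hausdorffMeasure_card_sub_one [DecidableEq P] (p₀ : P) :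
    (μH[(Fintype.card P : ℝ) - 1] : Measure ({p : P // p ≠ p₀} → ℝ)) = volume := by
  rw [← hausdorffMeasure_pi_real]
  congr 1
  have : Fintype.card {p : P // p ≠ p₀} = Fintype.card P - 1 := by simp
  rw [this, Nat.cast_sub (Fintype.card_pos_iff.mpr ⟨p₀⟩), Nat.cast_one]

lemma card_sub_one_nonneg [Nonempty P] : (0 : ℝ) ≤ (Fintype.card P : ℝ) - 1 := by
  have : (1 : ℝ) ≤ Fintype.card P := by exact_mod_cast Fintype.card_pos (α := P)
  linarith

lemma hausdorffMeasure_stdSimplex_lt_top [Nonempty P] :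
    μH[(Fintype.card P : ℝ) - 1] (stdSimplex ℝ P) < ⊤ := by
  classical
  obtain ⟨p₀⟩ := ‹Nonempty P›
  have : Nonempty P := ⟨p₀⟩
  set r : (P → ℝ) → ({p : P // p ≠ p₀} → ℝ) := fun x q => x q with hr
  have hcont : Continuous r := by fun_prop
  have himg : simplexLift p₀ '' (r '' stdSimplex ℝ P) = stdSimplex ℝ P := by
    rw [Set.image_image]
    exact (Set.image_congr fun x hx => simplexLift_restrict p₀ hx.2).trans (Set.image_id _)
  rw [← himg]
  refine ((lipschitzWith_simplexLift p₀).hausdorffMeasure_image_le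
    card_sub_one_nonneg _).trans_lt ?_
  rw [hausdorffMeasure_card_sub_one]
  refine ENNReal.mul_lt_top ?_ ((isCompact_stdSimplex ℝ P).image hcont).measure_lt_top
  exact ENNReal.rpow_lt_top_of_nonneg card_sub_one_nonneg (by simp)

lemma exists_pos_mem_stdSimplex_inter [Nonempty P] {U : Set (P → ℝ)} (hU : IsOpen U)
    (hne : (U ∩ stdSimplex ℝ P).Nonempty) :
    ∃ x ∈ U ∩ stdSimplex ℝ P, ∀ p, 0 < x p := by
  obtain ⟨x, hxU, hx⟩ := hne
  set c : ℝ := (Fintype.card P : ℝ)⁻¹ with hc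
  have hcpos : 0 < c := by
    rw [hc, inv_pos]; exact_mod_cast Fintype.card_pos (α := P)
  set g : ℝ → P → ℝ := fun t p => (1 - t) * x p + t * c with hg
  have hgc : Continuous g := by fun_prop
  have hg0 : g 0 = x := by funext p; simp [hg]
  have hmem : ∀ᶠ t in 𝓝[>] (0 : ℝ), g t ∈ U :=
    (hgc.continuousAt.mono_left nhdsWithin_le_nhds).eventually
      (hU.mem_nhds (by rwa [hg0]))
  obtain ⟨t, htU, ht0, ht1⟩ := (hmem.and (Ioo_mem_nhdsGT (zero_lt_one' ℝ))).exists
  have hpos : ∀ p, 0 < g t p := fun p =>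
    add_pos_of_nonneg_of_pos (mul_nonneg (by linarith) (hx.1 p)) (mul_pos ht0 hcpos)
  refine ⟨g t, ⟨htU, fun p => (hpos p).le, ?_⟩, hpos⟩
  simp only [hg, Finset.sum_add_distrib, ← Finset.mul_sum, hx.2]
  simp [hc]

lemma hausdorffMeasure_inter_stdSimplex_pos [Nonempty P] {U : Set (P → ℝ)} (hU : IsOpen U)
    (hne : (U ∩ stdSimplex ℝ P).Nonempty) :
    0 < μH[(Fintype.card P : ℝ) - 1] (U ∩ stdSimplex ℝ P) := by
  obtain ⟨x, ⟨hxU, hx⟩, hxpos⟩ := exists_pos_mem_stdSimplex_inter hU hne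
  classical
  obtain ⟨p₀⟩ := ‹Nonempty P›
  have : Nonempty P := ⟨p₀⟩
  set r : (P → ℝ) → ({p : P // p ≠ p₀} → ℝ) := fun x q => x q with hr
  have hlip : LipschitzWith 1 r := LipschitzWith.of_dist_le_mul fun x y => by
    rw [NNReal.coe_one, one_mul, dist_pi_le_iff dist_nonneg]
    exact fun q => dist_le_pi_dist x y q
  set V : Set ({p : P // p ≠ p₀} → ℝ) :=
    simplexLift p₀ ⁻¹' (U ∩ {z | ∀ p, 0 < z p}) with hV
  have hopen : IsOpen V := by
    refine (hU.inter ?_).preimage (continuous_simplexLift p₀)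
    rw [Set.ofPred_forall]
    exact isOpen_iInter_of_finite fun p => isOpen_lt continuous_const (continuous_apply p)
  have hVne : V.Nonempty := ⟨r x, by
    rw [hV, Set.mem_preimage, hr, simplexLift_restrict p₀ hx.2]; exact ⟨hxU, hxpos⟩⟩
  have hsub : V ⊆ r '' (U ∩ stdSimplex ℝ P) := fun y hy =>
    ⟨simplexLift p₀ y, ⟨hy.1, fun p => (hy.2 p).le, sum_simplexLift p₀ y⟩,
      restrict_simplexLift p₀ y⟩
  calc 0 < volume V := hopen.measure_pos _ hVne
    _ ≤ volume (r '' (U ∩ stdSimplex ℝ P)) := measure_mono hsub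
    _ = μH[(Fintype.card P : ℝ) - 1] (r '' (U ∩ stdSimplex ℝ P)) := by
        rw [hausdorffMeasure_card_sub_one]
    _ ≤ _ := by
        simpa using hlip.hausdorffMeasure_image_le card_sub_one_nonneg (U ∩ stdSimplex ℝ P)

lemma hausdorffMeasure_stdSimplex_ne_zero [Nonempty P] :
    μH[(Fintype.card P : ℝ) - 1] (stdSimplex ℝ P) ≠ 0 := by
  have hne : (Set.univ ∩ stdSimplex ℝ P).Nonempty := by
    classical
    obtain ⟨p₀⟩ := ‹Nonempty P›
    exact ⟨_, trivial, single_mem_stdSimplex ℝ p₀⟩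
  simpa using (hausdorffMeasure_inter_stdSimplex_pos isOpen_univ hne).ne'

lemma fullSupportOnSimplex_unifSimplex [Nonempty P] :
    FullSupportOnSimplex (unifSimplex P) := by
  have h0 := hausdorffMeasure_stdSimplex_ne_zero (P := P)
  have ht := (hausdorffMeasure_stdSimplex_lt_top (P := P)).ne
  have hm : MeasurableSet (stdSimplex ℝ P) := (isClosed_stdSimplex ℝ P).measurableSet
  refine ⟨⟨?_⟩, ?_, fun U hU hne => ?_⟩
  · simp [unifSimplex, ENNReal.inv_mul_cancel h0 ht]
  · simp [unifSimplex, Measure.restrict_apply hm.compl]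
  · simp only [unifSimplex, Measure.smul_apply, smul_eq_mul, Measure.restrict_apply' hm]
    exact ENNReal.mul_pos (ENNReal.inv_ne_zero.mpr ht)
      (hausdorffMeasure_inter_stdSimplex_pos hU hne).ne'

lemma FullSupportOnSimplex.integrable_of_continuousOn {η : Measure (P → ℝ)}
    (hη : FullSupportOnSimplex η) {g : (P → ℝ) → ℝ} (hg : ContinuousOn g (stdSimplex ℝ P)) :
    Integrable g η := by
  have := hη.1
  have hres : η.restrict (stdSimplex ℝ P) = η :=
    Measure.restrict_eq_self_of_ae_mem (by rw [ae_iff]; exact hη.2.1)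
  rw [← hres]
  exact hg.integrableOn_compact (isCompact_stdSimplex ℝ P)

lemma isProbabilityMeasure_pertOf {η : Measure (P → ℝ)} [IsProbabilityMeasure η] {ε : ℝ}
    (h0 : 0 ≤ ε) (h1 : ε ≤ 1) (τ : P → ℝ) : IsProbabilityMeasure (pertOf ε η τ) := by
  refine ⟨?_⟩
  simp only [pertOf, Measure.add_apply, Measure.smul_apply, measure_univ, smul_eq_mul, mul_one]
  rw [← ENNReal.ofReal_add (by linarith) h0]
  simp

lemma integral_pertOf {η : Measure (P → ℝ)} {ε : ℝ} (h0 : 0 ≤ ε) (h1 : ε ≤ 1)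
    {g : (P → ℝ) → ℝ} (hg : Integrable g η) (τ : P → ℝ) :
    ∫ x, g x ∂(pertOf ε η τ) = (1 - ε) * g τ + ε * ∫ x, g x ∂η := by
  have hd : Integrable g (Measure.dirac τ) := integrable_dirac (by simp)
  rw [pertOf, integral_add_measure (hd.smul_measure ENNReal.ofReal_ne_top)
    (hg.smul_measure ENNReal.ofReal_ne_top), integral_smul_measure, integral_smul_measure,
    integral_dirac, ENNReal.toReal_ofReal (by linarith), ENNReal.toReal_ofReal h0]
  rfl

lemma isPerturbation_pertOf {η : Measure (P → ℝ)} (hη : FullSupportOnSimplex η) {ε : ℝ}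
    (h0 : 0 < ε) (h1 : ε ≤ 1) : IsPerturbation (pertOf ε η) := by
  have := hη.1
  refine ⟨fun τ hτ => ⟨isProbabilityMeasure_pertOf h0.le h1 τ, ?_, fun U hU hne => ?_⟩,
    fun g hg => ?_⟩
  · simp [pertOf, hη.2.1, hτ]
  · simp only [pertOf, Measure.add_apply, Measure.smul_apply, smul_eq_mul]
    exact (ENNReal.mul_pos (by simpa using h0) (hη.2.2 U hU hne).ne').trans_le le_add_self
  · simp_rw [integral_pertOf h0.le h1 (hη.integrable_of_continuousOn hg.continuousOn)]
    exact (hg.measurable.const_mul _).add_const _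

lemma le_pertOf_singleton (η : Measure (P → ℝ)) (ε : ℝ) (τ : P → ℝ) :
    ENNReal.ofReal (1 - ε) ≤ pertOf ε η τ {τ} := by
  simp [pertOf]

end UniformSimplex

section CongestionGame

variable {E P : Type*} [Fintype P] [DecidableEq E]

lemma edgeLoad_mem_Icc (edgeOf : P → Finset E) {τ : P → ℝ} (hτ : τ ∈ stdSimplex ℝ P) (e : E) :
    edgeLoad edgeOf τ e ∈ Set.Icc (0 : ℝ) 1 := by
  refine ⟨Finset.sum_nonneg fun p _ => ?_, ?_⟩
  · split_ifs
    exacts [hτ.1 p, le_rfl]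
  · rw [← hτ.2]
    refine Finset.sum_le_sum fun p _ => ?_
    split_ifs
    exacts [le_rfl, hτ.1 p]

lemma continuous_edgeLoad (edgeOf : P → Finset E) (e : E) :
    Continuous fun τ => edgeLoad edgeOf τ e := by
  refine continuous_finsetSum _ fun p _ => ?_
  split_ifs <;> fun_prop

lemma IsCongestionCost.continuousOn_edgeLoad [Fintype E] {C : E → ℝ → ℝ} (hC : IsCongestionCost C)
    (edgeOf : P → Finset E) (e : E) :
    ContinuousOn (fun τ => C e (edgeLoad edgeOf τ e)) (stdSimplex ℝ P) :=
  (hC e).1.comp (continuous_edgeLoad edgeOf e).continuousOn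
    fun _ hτ => edgeLoad_mem_Icc edgeOf hτ e

/-- Against the uniform perturbation, the expected payoff of a path is minus its perturbed cost. -/
lemma payM_congPayoff_pertOf [Fintype E] [Nonempty P] {I : Type*} (i : I) (edgeOf : P → Finset E)
    {C : E → ℝ → ℝ} (hC : IsCongestionCost C) {ε : ℝ} (h0 : 0 ≤ ε) (h1 : ε ≤ 1)
    (p : P) (τ : P → ℝ) :
    payM (congPayoff I edgeOf C i) p (pertOf ε (unifSimplex P) τ) =
      -∑ e ∈ edgeOf p, pertCost edgeOf C ε e (edgeLoad edgeOf τ e) := by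
  have hint : ∀ e ∈ edgeOf p,
      Integrable (fun τ => C e (edgeLoad edgeOf τ e)) (unifSimplex P) := fun e _ =>
    fullSupportOnSimplex_unifSimplex.integrable_of_continuousOn
      (hC.continuousOn_edgeLoad edgeOf e)
  have hsum : Integrable (fun τ => pathCost edgeOf C p τ) (unifSimplex P) :=
    integrable_finsetSum _ hint
  simp only [payM, congPayoff]
  rw [integral_neg, integral_pertOf h0 h1 hsum]
  simp only [pathCost, pertCost]
  rw [integral_finsetSum _ hint, Finset.sum_add_distrib, Finset.mul_sum, Finset.mul_sum]

lemma IsCongestionCost.continuousOn_pertCost [Fintype E] {C : E → ℝ → ℝ} (hC : IsCongestionCost C)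
    (edgeOf : P → Finset E) (ε : ℝ) (e : E) :
    ContinuousOn (pertCost edgeOf C ε e) (Set.Icc 0 1) :=
  (continuousOn_const.mul (hC e).1).add continuousOn_const

lemma IsCongestionCost.monotoneOn_pertCost [Fintype E] {C : E → ℝ → ℝ} (hC : IsCongestionCost C)
    (edgeOf : P → Finset E) {ε : ℝ} (h1 : ε ≤ 1) (e : E) :
    MonotoneOn (pertCost edgeOf C ε e) (Set.Icc 0 1) := fun _ hx _ hy hxy =>
  add_le_add_left (mul_le_mul_of_nonneg_left ((hC e).2.1 hx hy hxy) (sub_nonneg.mpr h1)) _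

/-- The integral of a monotone function is at most the length times the value at the endpoint,
whichever way the interval is oriented. -/
lemma MonotoneOn.intervalIntegral_le_sub_mul {g : ℝ → ℝ} {s : Set ℝ} [hs : s.OrdConnected]
    (hg : MonotoneOn g s) {a b : ℝ} (ha : a ∈ s) (hb : b ∈ s) :
    ∫ x in a..b, g x ≤ (b - a) * g b := by
  have hsub : Set.uIcc a b ⊆ s := hs.uIcc_subset ha hb
  have hint : IntervalIntegrable g volume a b := (hg.mono hsub).intervalIntegrable
  rcases le_total a b with hab | hab
  · rw [Set.uIcc_of_le hab] at hsub
    have := intervalIntegral.integral_mono_on hab hint intervalIntegrable_const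
      fun x hx => hg (hsub hx) hb hx.2
    simpa using this
  · rw [Set.uIcc_of_ge hab] at hsub
    have := intervalIntegral.integral_mono_on hab intervalIntegrable_const hint.symm
      fun x hx => hg hb (hsub hx) hx.1
    rw [intervalIntegral.integral_symm]
    simp only [intervalIntegral.integral_const, smul_eq_mul] at this
    linarith

/-- A minimizer of the Beckmann objective over the flows with all coordinates at least `ε` puts
only the minimal weight `ε` on every path that is more costly than another one. -/
lemma eq_of_cost_lt_of_isMin [Fintype E] [DecidableEq P] (edgeOf : P → Finset E) {g : E → ℝ → ℝ}
    (hcont : ∀ e, ContinuousOn (g e) (Set.Icc 0 1))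
    (hmono : ∀ e, MonotoneOn (g e) (Set.Icc 0 1)) {ε : ℝ} (hε : 0 ≤ ε) {τ : P → ℝ}
    (hτ : τ ∈ stdSimplex ℝ P) (hlb : ∀ p, ε ≤ τ p)
    (hmin : ∀ σ ∈ stdSimplex ℝ P, (∀ p, ε ≤ σ p) →
      (∑ e : E, ∫ x in (0 : ℝ)..(edgeLoad edgeOf τ e), g e x) ≤
        ∑ e : E, ∫ x in (0 : ℝ)..(edgeLoad edgeOf σ e), g e x)
    {p q : P} (hpq : ∑ e ∈ edgeOf q, g e (edgeLoad edgeOf τ e) <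
      ∑ e ∈ edgeOf p, g e (edgeLoad edgeOf τ e)) :
    τ p = ε := by
  by_contra hne
  have hlt : 0 < τ p - ε := sub_pos.mpr (lt_of_le_of_ne (hlb p) (Ne.symm hne))
  have hpq' : p ≠ q := by rintro rfl; exact lt_irrefl _ hpq
  set σ : ℝ → P → ℝ := fun t r => τ r + t * ((if r = q then 1 else 0) - if r = p then 1 else 0)
    with hσ
  set c : E → ℝ := fun e => (if e ∈ edgeOf q then 1 else 0) - if e ∈ edgeOf p then 1 else 0
    with hc
  have hload : ∀ t e, edgeLoad edgeOf (σ t) e = edgeLoad edgeOf τ e + t * c e := by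
    intro t e
    have : ∀ r, (if e ∈ edgeOf r then σ t r else 0) = (if e ∈ edgeOf r then τ r else 0) +
        t * ((if r = q then (if e ∈ edgeOf r then 1 else 0) else 0) -
          if r = p then (if e ∈ edgeOf r then 1 else 0) else 0) := by
      intro r
      by_cases h : e ∈ edgeOf r <;> simp [h, hσ]
    simp only [edgeLoad, this, Finset.sum_add_distrib, ← Finset.mul_sum,
      Finset.sum_sub_distrib, Finset.sum_ite_eq', Finset.mem_univ, if_true, hc]
  have hσlb : ∀ t ∈ Set.Ioo 0 (τ p - ε), ∀ r, ε ≤ σ t r := by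
    intro t ht r
    have := hlb r
    have h0 := ht.1
    have h1 := ht.2
    by_cases hrp : r = p
    · subst hrp
      simp only [hσ, hpq', if_true, if_false]
      linarith
    · simp only [hσ, hrp, if_false]
      split_ifs <;> linarith
  have hσmem : ∀ t ∈ Set.Ioo 0 (τ p - ε), σ t ∈ stdSimplex ℝ P := by
    intro t ht
    refine ⟨fun r => hε.trans (hσlb t ht r), ?_⟩
    simp [hσ, Finset.sum_add_distrib, ← Finset.mul_sum, Finset.sum_sub_distrib, hτ.2]
  have hle : ∀ t ∈ Set.Ioo 0 (τ p - ε),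
      0 ≤ ∑ e, c e * g e (edgeLoad edgeOf τ e + t * c e) := by
    intro t ht
    have h := hmin _ (hσmem t ht) (hσlb t ht)
    have hle : ∀ e, (∫ x in (0 : ℝ)..(edgeLoad edgeOf (σ t) e), g e x) -
        (∫ x in (0 : ℝ)..(edgeLoad edgeOf τ e), g e x) ≤
          t * (c e * g e (edgeLoad edgeOf τ e + t * c e)) := by
      intro e
      have ha := edgeLoad_mem_Icc edgeOf hτ e
      have hb := edgeLoad_mem_Icc edgeOf (hσmem t ht) e
      have hzero : (0 : ℝ) ∈ Set.Icc (0 : ℝ) 1 := by simp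
      have hint : ∀ b ∈ Set.Icc (0 : ℝ) 1, IntervalIntegrable (g e) volume 0 b := fun b hb =>
        ((hmono e).mono (Set.ordConnected_Icc.uIcc_subset hzero hb)).intervalIntegrable
      rw [intervalIntegral.integral_interval_sub_left (hint _ hb) (hint _ ha)]
      refine ((hmono e).intervalIntegral_le_sub_mul ha hb).trans_eq ?_
      rw [hload]
      ring
    have hsum := Finset.sum_le_sum fun e (_ : e ∈ Finset.univ) => hle e
    rw [Finset.sum_sub_distrib, ← Finset.mul_sum] at hsum
    exact nonneg_of_mul_nonneg_right ((sub_nonneg.mpr h).trans hsum) ht.1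
  have hIoo : ∀ᶠ t in 𝓝[>] (0 : ℝ), t ∈ Set.Ioo 0 (τ p - ε) := Ioo_mem_nhdsGT hlt
  have hlim : Tendsto (fun t => ∑ e, c e * g e (edgeLoad edgeOf τ e + t * c e)) (𝓝[>] (0 : ℝ))
      (𝓝 (∑ e, c e * g e (edgeLoad edgeOf τ e))) := by
    refine tendsto_finsetSum _ fun e _ => Tendsto.const_mul _ ?_
    refine (hcont e _ (edgeLoad_mem_Icc edgeOf hτ e)).tendsto.comp
      (tendsto_nhdsWithin_iff.mpr ⟨?_, ?_⟩)
    · refine Tendsto.mono_left ?_ nhdsWithin_le_nhds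
      exact (by fun_prop : Continuous fun t => edgeLoad edgeOf τ e + t * c e).tendsto' _ _
        (by simp)
    · filter_upwards [hIoo] with t ht
      rw [← hload]
      exact edgeLoad_mem_Icc edgeOf (hσmem t ht) e
  have hnonneg := ge_of_tendsto hlim (hIoo.mono hle)
  simp only [hc, sub_mul, ite_mul, one_mul, zero_mul, Finset.sum_sub_distrib,
    Finset.sum_ite_mem, Finset.univ_inter] at hnonneg
  linarith

end CongestionGame

section Profiles

variable {I A : Type*}

/-- If `τₖ → τ` with `τₖ > 0` and `τ ≥ 0`, some factors `ρₖ → 1` make `ρₖ τ < τₖ`. -/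
lemma exists_tendsto_one_mul_lt [Fintype A] {τ : A → ℝ} (hτ : ∀ a, 0 ≤ τ a) {σ : ℕ → A → ℝ}
    (hσ : ∀ k a, 0 < σ k a) (hlim : Tendsto σ atTop (𝓝 τ)) :
    ∃ ρ : ℕ → ℝ, (∀ k, 0 ≤ ρ k) ∧ (∀ k a, ρ k * τ a < σ k a) ∧
      Tendsto ρ atTop (𝓝 1) := by
  set m : ℕ → A → ℝ := fun k a => if τ a = 0 then 1 else min 1 (σ k a / τ a) with hm
  have hm0 : ∀ k a, 0 ≤ m k a := fun k a => by
    simp only [hm]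
    split_ifs
    · exact zero_le_one
    · exact le_min zero_le_one (div_nonneg (hσ k a).le (hτ a))
  have hm1 : ∀ k a, m k a ≤ 1 := fun k a => by
    simp only [hm]
    split_ifs
    exacts [le_rfl, min_le_left _ _]
  have hmle : ∀ k a, m k a * τ a ≤ σ k a := fun k a => by
    simp only [hm]
    split_ifs with h
    · simpa [h] using (hσ k a).le
    · exact (mul_le_mul_of_nonneg_right (min_le_right _ _) (hτ a)).trans_eq
        (div_mul_cancel₀ _ h)
  have hprod0 : ∀ k, 0 ≤ ∏ a, m k a := fun k => Finset.prod_nonneg fun a _ => hm0 k a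
  have hprod1 : ∀ k a, ∏ b, m k b ≤ m k a := fun k a => by
    classical
    rw [← Finset.mul_prod_erase _ _ (Finset.mem_univ a)]
    exact mul_le_of_le_one_right (hm0 k a)
      (Finset.prod_le_one (fun b _ => hm0 k b) fun b _ => hm1 k b)
  set s : ℕ → ℝ := fun k => 1 - 1 / ((k : ℝ) + 2) with hs
  have hs0 : ∀ k, 0 ≤ s k := fun k => by
    have : (1 : ℝ) / ((k : ℝ) + 2) ≤ 1 := by
      rw [div_le_one (by positivity)]
      have := Nat.cast_nonneg (α := ℝ) k
      linarith
    simpa [hs] using this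
  have hs1 : ∀ k, s k < 1 := fun k => by
    have : (0 : ℝ) < 1 / ((k : ℝ) + 2) := by positivity
    simp only [hs]
    linarith
  refine ⟨fun k => s k * ∏ a, m k a, fun k => mul_nonneg (hs0 k) (hprod0 k),
    fun k a => ?_, ?_⟩
  · calc s k * (∏ b, m k b) * τ a ≤ s k * (m k a * τ a) := by
          rw [mul_assoc]
          exact mul_le_mul_of_nonneg_left
            (mul_le_mul_of_nonneg_right (hprod1 k a) (hτ a)) (hs0 k)
      _ ≤ s k * σ k a := mul_le_mul_of_nonneg_left (hmle k a) (hs0 k)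
      _ < σ k a := mul_lt_of_lt_one_left (hσ k a) (hs1 k)
  · have hslim : Tendsto s atTop (𝓝 1) := by
      have h2 : Tendsto (fun k : ℕ => 1 / ((k : ℝ) + 2)) atTop (𝓝 0) :=
        tendsto_const_nhds.div_atTop
          (tendsto_atTop_add_const_right _ _ tendsto_natCast_atTop_atTop)
      simpa [hs] using h2.const_sub 1
    have hmlim : Tendsto (fun k => ∏ a, m k a) atTop (𝓝 (∏ _a : A, (1 : ℝ))) := by
      refine tendsto_finsetProd _ fun a _ => ?_
      by_cases h : τ a = 0
      · simp [hm, h]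
      · have h3 := (tendsto_const_nhds (x := (1 : ℝ))).min
          ((tendsto_pi_nhds.mp hlim a).div_const (τ a))
        simpa [hm, h] using h3
    simpa using hslim.mul hmlim

/-- The profile that shifts weight from `f` towards the flow `σ`, with `f` keeping the share `ρ`
and the rest redistributed so that `τ` is moved to `σ`. -/
def shiftedProfile [DecidableEq A] (f : I → A) (τ σ : A → ℝ) (ρ : ℝ) : I → A → ℝ :=
  fun i a => ρ * (diracProfile f i a - τ a) + σ a

lemma shiftedProfile_pos [DecidableEq A] (f : I → A) {τ σ : A → ℝ} {ρ : ℝ} (hρ : 0 ≤ ρ)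
    (hlt : ∀ a, ρ * τ a < σ a) (i : I) (a : A) : 0 < shiftedProfile f τ σ ρ i a := by
  have h0 : 0 ≤ ρ * diracProfile f i a :=
    mul_nonneg hρ (by simp only [diracProfile]; split_ifs <;> simp)
  have := hlt a
  simp only [shiftedProfile, mul_sub]
  linarith

/-- Players of a shifted profile give only small weight to an action of small weight in `σ`. -/
lemma shiftedProfile_le [Fintype A] [DecidableEq A] {f : I → A} {τ σ : A → ℝ} {ρ ε : ℝ} (hτ : ∀ a, 0 ≤ τ a) (hρ : 0 ≤ ρ)
    (hε : 0 ≤ ε) (hlt : ∀ a, ρ * τ a < σ a) {i : I} (hi : 0 < τ (f i)) {a : A} (ha : σ a = ε) :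
    shiftedProfile f τ σ ρ i a ≤ (1 + ∑ b, (τ b)⁻¹) * ε := by
  have hinv : (τ a)⁻¹ ≤ ∑ b, (τ b)⁻¹ :=
    Finset.single_le_sum (f := fun b => (τ b)⁻¹) (fun b _ => inv_nonneg.mpr (hτ b))
      (Finset.mem_univ a)
  have hsum : 0 ≤ ∑ b, (τ b)⁻¹ := Finset.sum_nonneg fun b _ => inv_nonneg.mpr (hτ b)
  have hρτ : 0 ≤ ρ * τ a := mul_nonneg hρ (hτ a)
  have hsε := mul_nonneg hsum hε
  simp only [shiftedProfile, diracProfile, ha]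
  split_ifs with h
  · subst h
    have hρle : ρ ≤ (τ (f i))⁻¹ * ε := by
      rw [inv_mul_eq_div, le_div_iff₀ hi, ← ha]
      exact (hlt _).le
    have := mul_le_mul_of_nonneg_right hinv hε
    linarith
  · linarith

variable [MeasurableSpace I] [DecidableEq A] [MeasurableSpace A] [MeasurableSingletonClass A]

lemma measurable_diracProfile {f : I → A} (hf : Measurable f) (a : A) :
    Measurable fun i => diracProfile f i a := by
  refine Measurable.ite ?_ measurable_const measurable_const
  have : {i | a = f i} = f ⁻¹' {a} := by ext i; simp [eq_comm]
  rw [this]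
  exact hf (measurableSet_singleton a)

lemma integrable_diracProfile (lam : Measure I) [IsFiniteMeasure lam] {f : I → A}
    (hf : Measurable f) (a : A) : Integrable (fun i => diracProfile f i a) lam := by
  refine Integrable.of_bound (measurable_diracProfile hf a).aestronglyMeasurable 1
    (ae_of_all _ fun i => ?_)
  simp only [diracProfile]
  split_ifs <;> simp

lemma isProfile_diracProfile [Fintype A] (lam : Measure I) {f : I → A} (hf : Measurable f) :
    IsProfile lam (diracProfile f) :=
  ⟨measurable_pi_iff.mpr (measurable_diracProfile hf), fun i =>
    ⟨fun a => by simp only [diracProfile]; split_ifs <;> simp, by simp [diracProfile]⟩⟩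

lemma socSum_diracProfile [Fintype A] (lam : Measure I) {f : I → A} (hf : Measurable f) {τ : A → ℝ}
    (hτ : ∀ a, 0 ≤ τ a) (hdist : ∀ a, lam (f ⁻¹' {a}) = ENNReal.ofReal (τ a)) :
    socSum lam (diracProfile f) = τ := by
  funext a
  have : (fun i => diracProfile f i a) = (f ⁻¹' {a}).indicator 1 := by
    funext i
    simp only [diracProfile, Set.indicator, Set.mem_preimage, Set.mem_singleton_iff,
      Pi.one_apply, eq_comm]
  rw [socSum, this, integral_indicator_one (hf (measurableSet_singleton a)), Measure.real,
    hdist, ENNReal.toReal_ofReal (hτ a)]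

lemma socSum_shiftedProfile [Fintype A] (lam : Measure I) [IsProbabilityMeasure lam] {f : I → A}
    (hf : Measurable f) {τ : A → ℝ} (hsoc : socSum lam (diracProfile f) = τ) (σ : A → ℝ)
    (ρ : ℝ) : socSum lam (shiftedProfile f τ σ ρ) = σ := by
  funext a
  have hint := integrable_diracProfile lam hf a
  have ha : ∫ i, diracProfile f i a ∂lam = τ a := congrFun hsoc a
  simp only [socSum, shiftedProfile]
  have hsub : Integrable (fun i => diracProfile f i a - τ a) lam := hint.sub (integrable_const _)
  rw [integral_add (hsub.const_mul _) (integrable_const _), integral_const_mul,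
    integral_sub hint (integrable_const _), ha]
  simp

lemma isProfile_shiftedProfile [Fintype A] (lam : Measure I) {f : I → A} (hf : Measurable f)
    {τ σ : A → ℝ} {ρ : ℝ} (hτ : ∑ a, τ a = 1) (hσ : ∑ a, σ a = 1) (hρ : 0 ≤ ρ)
    (hlt : ∀ a, ρ * τ a < σ a) : IsProfile lam (shiftedProfile f τ σ ρ) := by
  refine ⟨measurable_pi_iff.mpr fun a =>
    (((measurable_diracProfile hf a).sub_const _).const_mul _).add_const _, fun i =>
    ⟨fun a => (shiftedProfile_pos f hρ hlt i a).le, ?_⟩⟩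
  simp only [shiftedProfile, Finset.sum_add_distrib, ← Finset.mul_sum, Finset.sum_sub_distrib,
    hτ, hσ, ((isProfile_diracProfile lam hf).2 i).2]
  simp

end Profiles

/-- Let `εₙ ∈ (0, 1/|𝒫|)` with `εₙ → 0`, let `τⁿ` minimize the
`εₙ`-perturbed Beckmann objective over the flows in the simplex with every
coordinate at least `εₙ`, and let `τ*` be a limit point of `(τⁿ)`. Then every
measurable pure strategy profile with action distribution `τ*` is a pure
strategy robust perfect equilibrium of the congestion game. -/
theorem statement10 {I : Type*} [MeasurableSpace I]
    {E P : Type*} [Fintype E] [Fintype P] [Nonempty P] [DecidableEq E] [DecidableEq P]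
    [MeasurableSpace P] [MeasurableSingletonClass P]
    (lam : Measure I) [IsProbabilityMeasure lam] (hatomless : MeasAtomless lam)
    (edgeOf : P → Finset E) (hedge : ∀ p, (edgeOf p).Nonempty)
    (C : E → ℝ → ℝ) (hC : IsCongestionCost C)
    (εseq : ℕ → ℝ) (hεseq : ∀ n, εseq n ∈ Set.Ioo (0:ℝ) (1 / (Fintype.card P : ℝ)))
    (hεlim : Tendsto εseq atTop (nhds 0))
    (τseq : ℕ → P → ℝ)
    (hτmem : ∀ n, τseq n ∈ stdSimplex ℝ P) (hτlb : ∀ n p, εseq n ≤ τseq n p)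
    (hτmin : ∀ n, ∀ τ ∈ stdSimplex ℝ P, (∀ p, εseq n ≤ τ p) →
      (∑ e : E, ∫ x in (0:ℝ)..(edgeLoad edgeOf (τseq n) e), pertCost edgeOf C (εseq n) e x) ≤
        ∑ e : E, ∫ x in (0:ℝ)..(edgeLoad edgeOf τ e), pertCost edgeOf C (εseq n) e x)
    (τstar : P → ℝ)
    (hlimpt : ∃ nk : ℕ → ℕ, StrictMono nk ∧
      Tendsto (fun k => τseq (nk k)) atTop (nhds τstar)) :
    ∀ f : I → P, Measurable f → (∀ p : P, lam (f ⁻¹' {p}) = ENNReal.ofReal (τstar p)) →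
      IsRPE lam (congPayoff I edgeOf C) (diracProfile f) := by
  intro f hf hdist
  obtain ⟨nk, hnk, hlim⟩ := hlimpt
  have hτstar : τstar ∈ stdSimplex ℝ P :=
    (isClosed_stdSimplex ℝ P).mem_of_tendsto hlim (Eventually.of_forall fun k => hτmem _)
  have hε0 : ∀ n, 0 < εseq n := fun n => (hεseq n).1
  have hε1 : ∀ n, εseq n ≤ 1 := fun n =>
    (hεseq n).2.le.trans (by
      rw [one_div]
      exact inv_le_one_of_one_le₀ (by exact_mod_cast Fintype.card_pos (α := P)))
  obtain ⟨ρ, hρ0, hρlt, hρlim⟩ := exists_tendsto_one_mul_lt hτstar.1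
    (fun k p => (hε0 (nk k)).trans_le (hτlb (nk k) p)) hlim
  have hsoc : socSum lam (diracProfile f) = τstar := socSum_diracProfile lam hf hτstar.1 hdist
  set M : ℝ := 1 + ∑ p, (τstar p)⁻¹ with hM
  have hM1 : 1 ≤ M := le_add_of_nonneg_right
    (Finset.sum_nonneg fun p _ => inv_nonneg.mpr (hτstar.1 p))
  set hs : ℕ → I → P → ℝ := fun k => shiftedProfile f τstar (τseq (nk k)) (ρ k) with hhs
  set J : Set I := {i | 0 < τstar (f i)} with hJ
  have hJmeas : MeasurableSet J := hf (Set.toFinite {p | 0 < τstar p}).measurableSet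
  have hJae : ∀ᵐ i ∂lam, i ∈ J := by
    have hnull : ∀ p, τstar p = 0 → ∀ᵐ i ∂lam, f i ≠ p := fun p hp => by
      rw [ae_iff]
      simpa [hp, Set.preimage] using hdist p
    have hall : ∀ᵐ i ∂lam, ∀ p, τstar p = 0 → f i ≠ p := by
      rw [ae_all_iff]
      intro p
      by_cases hp : τstar p = 0
      · simpa [hp] using hnull p hp
      · simp [hp]
    filter_upwards [hall] with i hi
    exact lt_of_le_of_ne (hτstar.1 _) fun h => hi _ h.symm rfl
  have hsocs : ∀ k, socSum lam (hs k) = τseq (nk k) := fun k =>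
    socSum_shiftedProfile lam hf hsoc _ _
  have hεk : Tendsto (fun k => εseq (nk k)) atTop (𝓝 0) := hεlim.comp hnk.tendsto_atTop
  refine ⟨isProfile_diracProfile lam hf, fun k => M * εseq (nk k), hs, fun _ => J,
    fun k => pertOf (εseq (nk k)) (unifSimplex P),
    fun k => mul_pos (by linarith) (hε0 _), by simpa using hεk.const_mul M, fun k => ?_, ?_, ?_⟩
  · have hle : εseq (nk k) ≤ M * εseq (nk k) := le_mul_of_one_le_left (hε0 _).le hM1
    refine ⟨isProfile_shiftedProfile lam hf hτstar.2 (hτmem _).2 (hρ0 k) (hρlt k),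
      ae_of_all _ (shiftedProfile_pos f (hρ0 k) (hρlt k)), hJmeas, ?_,
      isPerturbation_pertOf fullSupportOnSimplex_unifSimplex (hε0 _) (hε1 _),
      fun τ _ => ?_, fun i hi am al hlt => ?_⟩
    · rw [prob_compl_eq_zero_iff hJmeas |>.mp hJae, ← ENNReal.ofReal_one]
      exact (ENNReal.ofReal_lt_ofReal_iff one_pos).mpr (by linarith [hε0 (nk k)])
    · exact (ENNReal.ofReal_le_ofReal (by linarith)).trans (le_pertOf_singleton _ _ τ)
    · rw [hsocs, payM_congPayoff_pertOf i edgeOf hC (hε0 _).le (hε1 _),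
        payM_congPayoff_pertOf i edgeOf hC (hε0 _).le (hε1 _), neg_lt_neg_iff] at hlt
      exact shiftedProfile_le hτstar.1 (hρ0 k) (hε0 _).le (hρlt k) hi
        (eq_of_cost_lt_of_isMin edgeOf (hC.continuousOn_pertCost edgeOf _)
          (hC.monotoneOn_pertCost edgeOf (hε1 _)) (hε0 _).le (hτmem _) (hτlb _) (hτmin _) hlt)
  · filter_upwards [hJae] with i hi
    refine ⟨id, strictMono_id, fun _ => hi, tendsto_pi_nhds.mpr fun p => ?_⟩
    have := (hρlim.mul_const (diracProfile f i p - τstar p)).add (tendsto_pi_nhds.mp hlim p)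
    simpa [hhs, shiftedProfile] using this
  · simpa only [hsocs, hsoc] using hlim
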